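/- Let a, b ∈ ℍ be pure unit quaternions with ⟨a, i⟩ = 0 (so a lies in the span of j and k). Then left multiplication by i, which under the identification (z,w) ↦ z + w·j is the generator ξ_{4,1}(z,w) = (e^{iπ/2}z, e^{iπ/2}w) of the ℤ₄ lens space action with quotient L(4,1), maps T(a,b,t) := {x ∈ S³ : ⟨conj(x)·a·x, b⟩ = t} onto T(a,b,−t) for every t ∈ ℝ. In particular the Clifford-type torus T(a,b,0) is invariant under the full ℤ₄-action {x ↦ x, x ↦ i·x, x ↦ −x, x ↦ −i·x}. -/

import Mathlib

open scoped Quaternion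

noncomputable section

/-- The embedding of `ℂ` into the quaternions as the span of `1` and `i`. -/
def Cq (z : ℂ) : ℍ[ℝ] := ⟨z.re, z.im, 0, 0⟩

/-- The quaternion `i`. -/
def iq : ℍ[ℝ] := ⟨0, 1, 0, 0⟩

/-- The quaternion `j`. -/
def jq : ℍ[ℝ] := ⟨0, 0, 1, 0⟩

/-- The real inner product on `ℍ ≅ ℝ⁴`: `⟨x, y⟩ = Re (x · conj y)`. -/
def qinner (x y : ℍ[ℝ]) : ℝ := (x * star y).re

/-- The flat torus `T(a,b,t) = {x ∈ S³ : ⟨conj(x)·a·x, b⟩ = t}`. -/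
def flatTorus (a b : ℍ[ℝ]) (t : ℝ) : Set ℍ[ℝ] :=
  {x | ‖x‖ = 1 ∧ qinner (star x * a * x) b = t}

theorem aux_iq_re : iq.re = 0 := rfl

theorem aux_iq_imI : iq.imI = 1 := rfl

theorem aux_iq_imJ : iq.imJ = 0 := rfl

theorem aux_iq_imK : iq.imK = 0 := rfl

theorem aux_jq_re : jq.re = 0 := rfl

theorem aux_jq_imI : jq.imI = 0 := rfl

theorem aux_jq_imJ : jq.imJ = 1 := rfl

theorem aux_jq_imK : jq.imK = 0 := rfl

theorem aux_Cq_re (z : ℂ) : (Cq z).re = z.re := rfl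

theorem aux_Cq_imI (z : ℂ) : (Cq z).imI = z.im := rfl

theorem aux_Cq_imJ (z : ℂ) : (Cq z).imJ = 0 := rfl

theorem aux_Cq_imK (z : ℂ) : (Cq z).imK = 0 := rfl

theorem aux_ii (x : ℍ[ℝ]) : iq * (iq * x) = -x := by
  have h : iq * iq = -1 := by
    ext <;> simp [aux_iq_re, aux_iq_imI, aux_iq_imJ, aux_iq_imK]
  rw [← mul_assoc, h, neg_one_mul]

theorem aux_norm : ‖iq‖ = 1 := by
  have h : ‖iq‖ * ‖iq‖ = 1 := by
    rw [← norm_mul]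
    have h : iq * iq = -1 := by
      ext <;> simp [aux_iq_re, aux_iq_imI, aux_iq_imJ, aux_iq_imK]
    rw [h, norm_neg, norm_one]
  nlinarith [norm_nonneg iq]

theorem aux_neg {a b : ℍ[ℝ]} {t : ℝ} {x : ℍ[ℝ]} (hx : x ∈ flatTorus a b t) :
    -x ∈ flatTorus a b t := by
  obtain ⟨h1, h2⟩ := hx
  refine ⟨by rwa [norm_neg], ?_⟩
  rw [← h2, star_neg]
  simp only [neg_mul, mul_neg, neg_neg]

theorem aux_i {a b : ℍ[ℝ]} (ha0 : a.re = 0) (hai : qinner a iq = 0) {t : ℝ} {x : ℍ[ℝ]}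
    (hx : x ∈ flatTorus a b t) : iq * x ∈ flatTorus a b (-t) := by
  obtain ⟨h1, h2⟩ := hx
  refine ⟨by rw [norm_mul, aux_norm, h1, one_mul], ?_⟩
  have hi : a.imI = 0 := by simpa [qinner, aux_iq_re, aux_iq_imI, aux_iq_imJ, aux_iq_imK] using hai
  have h : star iq * a * iq = -a := by
    ext <;> simp [aux_iq_re, aux_iq_imI, aux_iq_imJ, aux_iq_imK, ha0, hi]
  have h' : star (iq * x) * a * (iq * x) = -(star x * a * x) := by
    rw [star_mul]
    calc _ = star x * (star iq * a * iq) * x := by simp only [mul_assoc]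
      _ = _ := by rw [h]; simp only [mul_neg, neg_mul]
  rw [← h2, h']
  simp only [qinner, neg_mul, Quaternion.re_neg]

/-- For pure unit `a ⊥ i`, left multiplication by `i` (which under `(z,w) ↦ z + w·j`
is the generator `ξ_{4,1}(z,w) = (iz, iw)` of the `ℤ₄` lens space action of `L(4,1)`)
maps `T(a,b,t)` onto `T(a,b,−t)`; in particular the Clifford-type torus `T(a,b,0)` is
invariant under the full `ℤ₄`-action `{x, i·x, −x, −i·x}`. -/
theorem flatTorus_Z4_invariance (a b : ℍ[ℝ])
    (ha0 : a.re = 0) (ha1 : ‖a‖ = 1) (hb0 : b.re = 0) (hb1 : ‖b‖ = 1)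
    (hai : qinner a iq = 0) :
    (∀ z w : ℂ, iq * (Cq z + Cq w * jq) = Cq (Complex.I * z) + Cq (Complex.I * w) * jq) ∧
    (∀ t : ℝ, (fun x => iq * x) '' flatTorus a b t = flatTorus a b (-t)) ∧
    (fun x => iq * x) '' flatTorus a b 0 = flatTorus a b 0 ∧
    (fun x => -x) '' flatTorus a b 0 = flatTorus a b 0 ∧
    (fun x => -(iq * x)) '' flatTorus a b 0 = flatTorus a b 0 := by
  have key : ∀ t : ℝ, (fun x => iq * x) '' flatTorus a b t = flatTorus a b (-t) := by
    intro t
    ext y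
    constructor
    · rintro ⟨x, hx, rfl⟩
      exact aux_i ha0 hai hx
    · intro hy
      refine ⟨-(iq * y), ?_, ?_⟩
      · have := aux_neg (aux_i ha0 hai hy)
        rwa [neg_neg] at this
      · simp only [mul_neg, aux_ii, neg_neg]
  have i0 : ∀ x ∈ flatTorus a b 0, iq * x ∈ flatTorus a b 0 := by
    intro x hx
    have := aux_i ha0 hai hx
    rwa [neg_zero] at this
  refine ⟨?_, key, ?_, ?_, ?_⟩
  · intro z w
    ext <;> simp [aux_iq_re, aux_iq_imI, aux_iq_imJ, aux_iq_imK, aux_jq_re, aux_jq_imI, aux_jq_imJ, aux_jq_imK,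
      aux_Cq_re, aux_Cq_imI, aux_Cq_imJ, aux_Cq_imK]
  · rw [key, neg_zero]
  · ext y
    constructor
    · rintro ⟨x, hx, rfl⟩
      exact aux_neg hx
    · intro hy
      exact ⟨-y, aux_neg hy, neg_neg y⟩
  · ext y
    constructor
    · rintro ⟨x, hx, rfl⟩
      exact aux_neg (i0 x hx)
    · intro hy
      refine ⟨iq * y, i0 y hy, ?_⟩
      simp only [aux_ii, neg_neg]

end
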